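/- Let $a, b, c$ be positive integers with $ab \mid c$, $\gcd(a, b) = 1$, $\alpha$ an integer with $\gcd(\alpha, c) = 1$, and $n$ an integer. Suppose for each prime $p \mid a$ one has $v_p(a) = v_p(c)$ (so $\gcd(a, c/a) = 1$). Write $b' = \prod_{p : v_p(b) = v_p(c)} p^{v_p(c)}$ and $b'' = b/b'$. Then $S(an, b\alpha; c) = \delta_{b'' \mid n} \cdot b'' \cdot S(0, 1; a) \cdot S(0, n; b') \cdot S\left(\frac{n}{b''}, \alpha \overline{ab'}; \frac{c}{ab}\right)$, where $\overline{ab'}$ is the inverse of $ab'$ modulo $c/(ab)$ and $\delta_{b'' \mid n}$ equals $1$ if $b'' \mid n$ and $0$ otherwise. -/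

import Mathlib

open Finset

/-- `e(x) = e^{2πix}`. -/
noncomputable def efn (x : ℝ) : ℂ := Complex.exp (2 * Real.pi * Complex.I * x)

/-- Classical Kloosterman sum `S(a,b;c) = ∑_{x mod c, (x,c)=1} e((ax + b x̄)/c)`. -/
noncomputable def Kl (a b : ℤ) (c : ℕ) : ℂ :=
  ∑ x ∈ Finset.range c, if Nat.gcd x c = 1 then
    efn (((a * x + b * (((x : ZMod c)⁻¹).val : ℤ) : ℤ) : ℝ) / c) else 0


lemma efn_add (x y : ℝ) : efn (x + y) = efn x * efn y := by
  unfold efn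
  rw [← Complex.exp_add]
  push_cast
  ring_nf

lemma efn_int (k : ℤ) : efn (k : ℝ) = 1 := by
  unfold efn
  rw [Complex.exp_eq_one_iff]
  exact ⟨k, by push_cast; ring⟩

lemma efn_congr {c : ℕ} (hc : 0 < c) {k l : ℤ} (h : k ≡ l [ZMOD c]) :
    efn ((k : ℝ) / c) = efn ((l : ℝ) / c) := by
  obtain ⟨t, ht⟩ := h.dvd
  have hl : l = k + c * t := by linarith
  have hc' : (c : ℝ) ≠ 0 := by positivity
  have : (l : ℝ) / c = (k : ℝ) / c + (t : ℤ) := by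
    rw [hl]; push_cast; field_simp
  rw [this, efn_add, efn_int, mul_one]

/-- The inverse representative. -/
lemma inv_spec {c x : ℕ} (hc : 0 < c) (h : Nat.gcd x c = 1) :
    (x : ℤ) * (((x : ZMod c)⁻¹).val : ℤ) ≡ 1 [ZMOD c] := by
  have : NeZero c := ⟨hc.ne'⟩
  rw [← ZMod.intCast_eq_intCast_iff]
  push_cast
  rw [ZMod.natCast_zmod_val]
  exact ZMod.coe_mul_inv_eq_one x h

lemma modinv_unique {c : ℤ} {x y z : ℤ} (h1 : x * y ≡ 1 [ZMOD c]) (h2 : x * z ≡ 1 [ZMOD c]) :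
    y ≡ z [ZMOD c] := by
  have e1 : y * (x * z) ≡ y * 1 [ZMOD c] := h2.mul_left y
  have e2 : z * (x * y) ≡ z * 1 [ZMOD c] := h1.mul_left z
  have e3 : y * (x * z) = z * (x * y) := by ring
  rw [e3] at e1
  simpa using e1.symm.trans e2

lemma Kl_congr {c : ℕ} (hc : 0 < c) {m m' n n' : ℤ} (hm : m ≡ m' [ZMOD c])
    (hn : n ≡ n' [ZMOD c]) : Kl m n c = Kl m' n' c := by
  unfold Kl
  refine Finset.sum_congr rfl fun x _ => ?_
  split_ifs with h
  · exact efn_congr hc ((hm.mul_right _).add (hn.mul_right _))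
  · rfl

/-- value of the standard character at a residue -/
lemma efn_std {c : ℕ} [NeZero c] (k : ℤ) :
    efn ((k : ℝ) / c) = ZMod.stdAddChar (N := c) (k : ZMod c) := by
  rw [ZMod.stdAddChar_coe]
  unfold efn
  push_cast
  ring_nf

lemma Kl_eq {c : ℕ} [NeZero c] (m n : ℤ) :
    Kl m n c = ∑ x : (ZMod c)ˣ, ZMod.stdAddChar (N := c)
      ((m : ZMod c) * (x : ZMod c) + (n : ZMod c) * ((x⁻¹ : (ZMod c)ˣ) : ZMod c)) := by
  have hc : 0 < c := Nat.pos_of_ne_zero (NeZero.ne c)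
  unfold Kl
  rw [← Finset.sum_filter]
  symm
  refine Finset.sum_bij (fun x _ => (x : ZMod c).val) ?_ ?_ ?_ ?_
  · intro x _
    simp only [Finset.mem_filter, Finset.mem_range]
    exact ⟨ZMod.val_lt _, ZMod.val_coe_unit_coprime x⟩
  · intro x _ y _ h
    exact Units.ext (ZMod.val_injective c h)
  · intro k hk
    simp only [Finset.mem_filter, Finset.mem_range] at hk
    exact ⟨ZMod.unitOfCoprime k hk.2, Finset.mem_univ _, by
      simp [ZMod.coe_unitOfCoprime, ZMod.val_natCast, Nat.mod_eq_of_lt hk.1]⟩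
  · intro x _
    rw [efn_std]
    congr 1
    push_cast
    rw [ZMod.natCast_zmod_val, ZMod.natCast_zmod_val, ZMod.inv_coe_unit]

/-- scaling -/
lemma Kl_scale {c : ℕ} (hc : 0 < c) (m n : ℤ) {w : ℤ} (hw : IsCoprime w c) :
    Kl (m * w) n c = Kl m (n * w) c := by
  have : NeZero c := ⟨hc.ne'⟩
  rw [Kl_eq, Kl_eq]
  have hu : IsUnit ((w : ℤ) : ZMod c) := by
    obtain ⟨u, v, h⟩ := hw
    refine IsUnit.of_mul_eq_one (u : ZMod c) ?_
    have := congrArg (fun z : ℤ => (z : ZMod c)) h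
    push_cast at this
    simp at this
    rw [mul_comm]; exact this
  obtain ⟨W, hW⟩ := hu
  refine Fintype.sum_equiv (Equiv.mulLeft W) _ _ fun x => ?_
  congr 1
  push_cast
  rw [← hW]
  simp only [Equiv.coe_mulLeft, mul_inv, Units.val_mul]
  have : (W : ZMod c) * ((W⁻¹ : (ZMod c)ˣ) : ZMod c) = 1 := by simp
  linear_combination (-(n : ZMod c) * ((x⁻¹ : (ZMod c)ˣ) : ZMod c)) * this

lemma Kl_swap {c : ℕ} (hc : 0 < c) (m n : ℤ) : Kl m n c = Kl n m c := by
  have : NeZero c := ⟨hc.ne'⟩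
  rw [Kl_eq, Kl_eq]
  refine Fintype.sum_equiv (Equiv.inv _) _ _ fun x => ?_
  congr 1
  simp [add_comm]

lemma Kl_zero_scale {c : ℕ} (hc : 0 < c) (n : ℤ) {w : ℤ} (hw : IsCoprime w c) :
    Kl 0 (n * w) c = Kl 0 n c := by
  rw [← Kl_scale hc _ _ hw, zero_mul]

/-- twisted multiplicativity -/
lemma Kl_mul {M N : ℕ} (hM : 0 < M) (hN : 0 < N) (m n r s : ℤ) (h : r * M + s * N = 1) :
    Kl m n (M * N) = Kl (m * s) (n * s) M * Kl (m * r) (n * r) N := by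
  have : NeZero M := ⟨hM.ne'⟩
  have : NeZero N := ⟨hN.ne'⟩
  have : NeZero (M * N) := ⟨(Nat.mul_pos hM hN).ne'⟩
  have hcop : Nat.Coprime M N := by
    rw [← Nat.isCoprime_iff_coprime]; exact ⟨r, s, h⟩
  rw [Kl_eq, Kl_eq, Kl_eq, Finset.sum_mul_sum, ← Fintype.sum_prod_type']
  let e : (ZMod (M * N))ˣ ≃* (ZMod M)ˣ × (ZMod N)ˣ :=
    (Units.mapEquiv (ZMod.chineseRemainder hcop).toMulEquiv).trans MulEquiv.prodUnits
  have key : ∀ z : ZMod (M * N), ZMod.stdAddChar (N := M * N) z =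
      ZMod.stdAddChar (N := M) ((s : ZMod M) * (ZMod.chineseRemainder hcop z).1) *
      ZMod.stdAddChar (N := N) ((r : ZMod N) * (ZMod.chineseRemainder hcop z).2) := by
    intro z
    obtain ⟨k, rfl⟩ := ZMod.intCast_surjective z
    rw [map_intCast (ZMod.chineseRemainder hcop) k, Prod.fst_intCast, Prod.snd_intCast, ← Int.cast_mul, ← Int.cast_mul,
      ← efn_std, ← efn_std, ← efn_std, ← efn_add]
    congr 1
    have hM' : (M : ℝ) ≠ 0 := by positivity
    have hN' : (N : ℝ) ≠ 0 := by positivity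
    have h' : (r : ℝ) * M + s * N = 1 := by exact_mod_cast h
    push_cast
    field_simp
    linear_combination (-(k : ℝ)) * h'
  refine Fintype.sum_equiv e.toEquiv _ _ fun x => ?_
  have e1 : ((e x).1 : ZMod M) = (ZMod.chineseRemainder hcop (x : ZMod (M * N))).1 := rfl
  have e2 : ((e x).2 : ZMod N) = (ZMod.chineseRemainder hcop (x : ZMod (M * N))).2 := rfl
  have e3 : (((e x).1⁻¹ : (ZMod M)ˣ) : ZMod M) =
      (ZMod.chineseRemainder hcop ((x⁻¹ : (ZMod (M * N))ˣ) : ZMod (M * N))).1 := rfl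
  have e4 : (((e x).2⁻¹ : (ZMod N)ˣ) : ZMod N) =
      (ZMod.chineseRemainder hcop ((x⁻¹ : (ZMod (M * N))ˣ) : ZMod (M * N))).2 := rfl
  rw [key]
  simp only [MulEquiv.toEquiv_eq_coe, EquivLike.coe_coe]
  rw [e1, e2, e3, e4]
  simp only [map_add, map_mul, map_intCast, Prod.fst_add, Prod.fst_mul, Prod.snd_add,
    Prod.snd_mul, Prod.fst_intCast, Prod.snd_intCast]
  push_cast
  congr 2 <;> ring

lemma efn_geom {d : ℕ} (hd : 0 < d) (n : ℤ) :
    ∑ t ∈ Finset.range d, efn (((n * t : ℤ) : ℝ) / d) = if (d : ℤ) ∣ n then (d : ℂ) else 0 := by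
  have hd' : (d : ℝ) ≠ 0 := by positivity
  split_ifs with h
  · obtain ⟨k, rfl⟩ := h
    rw [Finset.sum_congr rfl (g := fun _ => (1 : ℂ))]
    · simp
    · intro t _
      rw [← efn_int (k * t)]
      congr 1
      push_cast
      field_simp
  · have hpow : ∀ t : ℕ, efn (((n * t : ℤ) : ℝ) / d) = efn ((n : ℝ) / d) ^ t := by
      intro t
      unfold efn
      rw [← Complex.exp_nat_mul]
      push_cast
      ring_nf
    rw [Finset.sum_congr rfl fun t _ => hpow t]
    have h1 : efn ((n : ℝ) / d) ^ d = 1 := by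
      rw [← hpow, ← efn_int n]
      congr 1
      push_cast
      field_simp
    have h2 : efn ((n : ℝ) / d) - 1 ≠ 0 := by
      intro h0
      have h3 : efn ((n : ℝ) / d) = 1 := by linear_combination h0
      unfold efn at h3
      rw [Complex.exp_eq_one_iff] at h3
      obtain ⟨k, hk⟩ := h3
      apply h
      refine ⟨k, ?_⟩
      have hdc : (d : ℂ) ≠ 0 := by exact_mod_cast hd.ne'
      have h4 : (n : ℂ) / d = k := by
        have := Complex.two_pi_I_ne_zero
        apply mul_left_cancel₀ this
        push_cast at hk
        rw [hk]; ring
      rw [div_eq_iff hdc] at h4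
      have h5 : n = k * d := by exact_mod_cast h4
      rw [h5, mul_comm]
    have := mul_geom_sum (efn ((n : ℝ) / d)) d
    rw [h1, sub_self] at this
    exact (mul_eq_zero.mp this).resolve_left h2

lemma sum_range_mul' (d q : ℕ) (hq : 0 < q) (f : ℕ → ℂ) :
    ∑ x ∈ Finset.range (d * q), f x =
      ∑ y ∈ Finset.range q, ∑ t ∈ Finset.range d, f (y + q * t) := by
  rw [← Finset.sum_product']
  symm
  refine Finset.sum_bij' (fun p _ => p.1 + q * p.2) (fun x _ => (x % q, x / q)) ?_ ?_ ?_ ?_ ?_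
  · rintro ⟨y, t⟩ h
    simp only [Finset.mem_product, Finset.mem_range] at h ⊢
    nlinarith [h.1, h.2]
  · intro x h
    simp only [Finset.mem_product, Finset.mem_range] at h ⊢
    exact ⟨Nat.mod_lt _ hq, Nat.div_lt_of_lt_mul (by rwa [mul_comm])⟩
  · rintro ⟨y, t⟩ h
    simp only [Finset.mem_product, Finset.mem_range] at h ⊢
    ext
    · simp [Nat.add_mul_mod_self_left, Nat.mod_eq_of_lt h.1]
    · simp [Nat.add_mul_div_left _ _ hq, Nat.div_eq_of_lt h.1]
  · intro x _
    exact Nat.mod_add_div x q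
  · intro x _
    rfl

/-- reduction of the modulus -/
lemma Kl_reduce {d q : ℕ} (hd : 0 < d) (hq : 0 < q)
    (hdq : ∀ p : ℕ, p.Prime → p ∣ d → p ∣ q) (n β : ℤ) :
    Kl n ((d : ℤ) * β) (d * q) =
      (if (d : ℤ) ∣ n then (d : ℂ) else 0) * Kl (n / (d : ℤ)) β q := by
  have hd' : (d : ℝ) ≠ 0 := by positivity
  have hq' : (q : ℝ) ≠ 0 := by positivity
  have hdq0 : 0 < d * q := Nat.mul_pos hd hq
  have hgcd : ∀ y t : ℕ, Nat.gcd (y + q * t) (d * q) = 1 ↔ Nat.gcd y q = 1 := by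
    intro y t
    change Nat.Coprime _ _ ↔ _
    rw [Nat.coprime_mul_iff_right]
    have h1 : Nat.Coprime (y + q * t) q ↔ Nat.gcd y q = 1 := by
      change Nat.gcd _ _ = 1 ↔ _
      rw [Nat.gcd_add_mul_left_left]
    rw [h1]
    refine ⟨fun h => h.2, fun h => ⟨?_, h⟩⟩
    refine Nat.Coprime.symm (Nat.coprime_of_dvd fun p hp hpd hpx => ?_)
    have := Nat.dvd_gcd hpx (hdq p hp hpd)
    have h2 : Nat.gcd (y + q * t) q = 1 := h1.2 h
    rw [h2] at this
    exact hp.one_lt.ne' (Nat.dvd_one.mp this)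
  have step : Kl n ((d : ℤ) * β) (d * q) = ∑ y ∈ Finset.range q, ∑ t ∈ Finset.range d,
      (if Nat.gcd y q = 1 then efn ((n * y : ℝ) / (d * q)) *
        efn (((β * (((y : ZMod q)⁻¹).val : ℤ) : ℤ) : ℝ) / q) else 0) *
        efn (((n * t : ℤ) : ℝ) / d) := by
    unfold Kl
    rw [sum_range_mul' d q hq]
    refine Finset.sum_congr rfl fun y _ => Finset.sum_congr rfl fun t _ => ?_
    by_cases hy : Nat.gcd y q = 1
    · rw [if_pos hy, if_pos ((hgcd y t).2 hy)]
      have i1 := inv_spec hdq0 ((hgcd y t).2 hy)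
      have i2 := inv_spec hq hy
      generalize ((((y + q * t : ℕ) : ZMod (d * q))⁻¹).val : ℤ) = I at i1 ⊢
      generalize (((y : ZMod q)⁻¹).val : ℤ) = J at i2 ⊢
      have i3 : (y : ℤ) * I ≡ 1 [ZMOD q] := by
        have i4 : ((y + q * t : ℕ) : ℤ) * I ≡ 1 [ZMOD q] :=
          i1.of_dvd (by push_cast; exact Dvd.intro_left _ rfl)
        refine Int.ModEq.trans ?_ i4
        rw [Int.modEq_iff_dvd]
        exact ⟨t * I, by push_cast; ring⟩
      have i5 := modinv_unique i3 i2
      rw [← efn_congr hq (i5.mul_left β), ← efn_add, ← efn_add]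
      congr 1
      push_cast
      field_simp
      ring
    · rw [if_neg hy, if_neg (fun h => hy ((hgcd y t).1 h)), zero_mul]
  rw [step]
  simp_rw [← Finset.mul_sum, efn_geom hd]
  rw [← Finset.sum_mul, mul_comm]
  split_ifs with h
  · congr 1
    obtain ⟨k, rfl⟩ := h
    rw [Int.mul_ediv_cancel_left _ (by exact_mod_cast hd.ne')]
    unfold Kl
    refine Finset.sum_congr rfl fun y _ => ?_
    split_ifs with hy
    · rw [← efn_add]
      congr 1
      push_cast
      field_simp
    · rfl
  · simp



/-- `S(an, bα; c) = δ_{b''∣n} b'' S(0,1;a) S(0,n;b') S(n/b'', α·(ab')⁻¹; c/(ab))`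
when `ab ∣ c`, `(a,b)=1`, `(α,c)=1`, and `v_p(a) = v_p(c)` for all primes `p ∣ a`. -/
theorem stmt5 (a b c : ℕ) (ha : 0 < a) (hb : 0 < b) (hc : 0 < c)
    (hab : a * b ∣ c) (hcop : Nat.Coprime a b)
    (n α : ℤ) (hα : Int.gcd α c = 1)
    (hafull : ∀ p : ℕ, p.Prime → p ∣ a → a.factorization p = c.factorization p)
    (b' b'' : ℕ)
    (hb' : b' = ∏ p ∈ b.primeFactors.filter
        (fun p => b.factorization p = c.factorization p), p ^ c.factorization p)
    (hb'' : b'' = b / b') :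
    Kl ((a : ℤ) * n) ((b : ℤ) * α) c =
      (if (b'' : ℤ) ∣ n then (b'' : ℂ) else 0) * Kl 0 1 a * Kl 0 n b' *
        Kl (n / (b'' : ℤ)) (α * ((((a * b' : ℕ) : ZMod (c / (a * b)))⁻¹).val : ℤ))
          (c / (a * b)) := by
  set T := b.primeFactors.filter (fun p => b.factorization p = c.factorization p) with hT
  have hTmem : ∀ p, p ∈ T → p.Prime ∧ p ∣ b ∧ b.factorization p = c.factorization p := by
    intro p hp
    rw [hT, Finset.mem_filter, Nat.mem_primeFactors] at hp
    exact ⟨hp.1.1, hp.1.2.1, hp.2⟩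
  have hb'b : b' ∣ b := by
    have h1 : ∏ p ∈ T, p ^ c.factorization p = ∏ p ∈ T, p ^ b.factorization p :=
      Finset.prod_congr rfl fun p hp => by rw [(hTmem p hp).2.2]
    have h2 : ∏ p ∈ b.primeFactors, p ^ b.factorization p = b :=
      Nat.prod_factorization_pow_eq_self hb.ne'
    rw [hb', h1]
    conv_rhs => rw [← h2]
    exact Finset.prod_dvd_prod_of_subset _ _ _ (Finset.filter_subset _ _)
  have hpow : ∀ p ∈ T, p ^ c.factorization p ∣ b' := fun p hp => by
    rw [hb']; exact Finset.dvd_prod_of_mem (fun p => p ^ c.factorization p) hp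
  have hpT : ∀ p, p.Prime → p ∣ b' → p ∈ T := by
    intro p hp hd
    rw [hb', hp.prime.dvd_finsetProd_iff] at hd
    obtain ⟨r, hr, hd⟩ := hd
    have := (Nat.prime_dvd_prime_iff_eq hp (hTmem r hr).1).1 (hp.dvd_of_dvd_pow hd)
    rwa [this]
  have hnot : ∀ p, p.Prime → ¬ p ^ (c.factorization p + 1) ∣ c := fun p hp =>
    Nat.pow_succ_factorization_not_dvd hc.ne' hp
  clear_value T
  have hbb : b = b' * b'' := by rw [hb'', Nat.mul_div_cancel' hb'b]
  obtain ⟨q, hq⟩ := hab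
  have hqdef : c / (a * b) = q := by
    rw [hq]; exact Nat.mul_div_cancel_left _ (Nat.mul_pos ha hb)
  rw [hqdef]
  have hb'0 : 0 < b' := Nat.pos_of_dvd_of_pos hb'b hb
  have hb''0 : 0 < b'' := by
    rcases Nat.eq_zero_or_pos b'' with h | h
    · rw [h] at hbb; omega
    · exact h
  have hq0 : 0 < q := by
    rcases Nat.eq_zero_or_pos q with h | h
    · rw [h] at hq; omega
    · exact h
  have hm0 : 0 < b'' * q := Nat.mul_pos hb''0 hq0
  have hM0 : 0 < b' * (b'' * q) := Nat.mul_pos hb'0 hm0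
  have hcM : c = a * (b' * (b'' * q)) := by rw [hq, hbb]; ring
  have cop1 : Nat.Coprime a (b' * (b'' * q)) := by
    refine Nat.coprime_of_dvd fun p hp h1 h2 => hnot p hp ?_
    rw [← hafull p hp h1, pow_succ, hcM]
    exact mul_dvd_mul (Nat.ordProj_dvd a p) h2
  have cop2 : Nat.Coprime b' (b'' * q) := by
    refine Nat.coprime_of_dvd fun p hp h1 h2 => hnot p hp ?_
    have := mul_dvd_mul (hpow p (hpT p hp h1)) h2
    rw [← pow_succ] at this
    exact this.trans ⟨a, by rw [hcM]; ring⟩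
  have hdq : ∀ p : ℕ, p.Prime → p ∣ b'' → p ∣ q := by
    intro p hp h1
    by_contra h2
    have hpb : p ∣ b := hbb ▸ Dvd.dvd.mul_left h1 b'
    have hpa : ¬ p ∣ a := fun h => by
      have := Nat.dvd_gcd h hpb
      rw [hcop] at this
      exact hp.one_lt.ne' (Nat.dvd_one.mp this)
    have hfe : b.factorization p = c.factorization p := by
      rw [hq, Nat.factorization_mul (Nat.mul_pos ha hb).ne' hq0.ne',
        Nat.factorization_mul ha.ne' hb.ne']
      simp [Nat.factorization_eq_zero_of_not_dvd hpa, Nat.factorization_eq_zero_of_not_dvd h2]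
    have hpT' : p ∈ T := by
      rw [hT, Finset.mem_filter, Nat.mem_primeFactors]
      exact ⟨⟨hp, hpb, hb.ne'⟩, hfe⟩
    apply hnot p hp
    rw [pow_succ]
    refine (mul_dvd_mul (hpow p hpT') h1).trans ?_
    rw [← hbb, hq]
    exact ⟨a * q, by ring⟩
  obtain ⟨r, s, hrs⟩ := Nat.isCoprime_iff_coprime.mpr cop1
  obtain ⟨r', s', hrs'⟩ := Nat.isCoprime_iff_coprime.mpr cop2
  have hαc : IsCoprime α (c : ℤ) := Int.isCoprime_iff_gcd_eq_one.mpr hα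
  have hαa : IsCoprime α (a : ℤ) :=
    hαc.of_isCoprime_of_dvd_right (by rw [hcM]; push_cast; exact Dvd.intro _ rfl)
  have hsa : IsCoprime s (a : ℤ) := ⟨((b' * (b'' * q) : ℕ) : ℤ), r, by linear_combination hrs⟩
  have hba : IsCoprime (b : ℤ) (a : ℤ) := (Nat.isCoprime_iff_coprime.mpr hcop).symm
  have hs'b : IsCoprime s' (b' : ℤ) := ⟨((b'' * q : ℕ) : ℤ), r', by linear_combination hrs'⟩
  have hr'm : IsCoprime r' ((b'' * q : ℕ) : ℤ) := ⟨(b' : ℤ), s', by linear_combination hrs'⟩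
  have E1 : Kl ((a : ℤ) * n * s) ((b : ℤ) * α * s) a = Kl 0 1 a := by
    rw [← Kl_zero_scale ha 1 ((hba.mul_left hαa).mul_left hsa)]
    refine Kl_congr ha ?_ ?_
    · rw [Int.modEq_zero_iff_dvd]; exact ⟨n * s, by ring⟩
    · rw [one_mul]
  have E2 : Kl ((a : ℤ) * n * r) ((b : ℤ) * α * r) (b' * (b'' * q)) =
      Kl n ((b : ℤ) * α * r) (b' * (b'' * q)) := by
    refine Kl_congr hM0 ?_ rfl
    rw [Int.modEq_iff_dvd]
    exact ⟨n * s, by linear_combination (-n) * hrs⟩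
  have E3 : Kl (n * s') ((b : ℤ) * α * r * s') b' = Kl 0 n b' := by
    rw [← Kl_zero_scale hb'0 n hs'b, Kl_swap hb'0 0]
    refine Kl_congr hb'0 rfl ?_
    rw [Int.modEq_zero_iff_dvd, hbb]
    exact ⟨b'' * α * r * s', by push_cast; ring⟩
  have E4 : Kl (n * r') ((b : ℤ) * α * r * r') (b'' * q) =
      Kl n ((b'' : ℤ) * (α * (r * r'))) (b'' * q) := by
    have : (b'' : ℤ) * (α * (r * r')) = ((b'' : ℤ) * α * r) * r' := by ring
    rw [this, ← Kl_scale hm0 n ((b'' : ℤ) * α * r) hr'm]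
    refine Kl_congr hm0 rfl ?_
    rw [Int.modEq_iff_dvd, hbb]
    exact ⟨b'' * α * r * s', by push_cast at hrs' ⊢; linear_combination (-(b'' * α * r : ℤ)) * hrs'⟩
  have cop3 : Nat.Coprime (a * b') q := by
    refine Nat.Coprime.mul_left ?_ ?_
    · exact cop1.coprime_dvd_right ⟨b' * b'', by ring⟩
    · exact cop2.coprime_dvd_right ⟨b'', by ring⟩
  have E5 : Kl (n / (b'' : ℤ)) (α * (r * r')) q =
      Kl (n / (b'' : ℤ)) (α * ((((a * b' : ℕ) : ZMod q)⁻¹).val : ℤ)) q := by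
    refine Kl_congr hq0 rfl (Int.ModEq.mul_left _ ?_)
    refine modinv_unique (x := ((a * b' : ℕ) : ℤ)) ?_ (inv_spec hq0 cop3)
    have h1 : r * (a : ℤ) ≡ 1 [ZMOD q] := by
      rw [Int.modEq_iff_dvd]
      exact ⟨s * b' * b'', by push_cast at hrs; linear_combination -hrs⟩
    have h2 : r' * (b' : ℤ) ≡ 1 [ZMOD q] := by
      rw [Int.modEq_iff_dvd]
      exact ⟨s' * b'', by push_cast at hrs'; linear_combination -hrs'⟩
    have h3 := h1.mul h2
    have h4 : ((a * b' : ℕ) : ℤ) * (r * r') = r * a * (r' * b') := by push_cast; ring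
    rw [h4]
    simpa using h3
  rw [← E5]
  clear E5
  conv_lhs => rw [hcM]
  rw [Kl_mul ha hM0 _ _ r s hrs, E1, E2, Kl_mul hb'0 hm0 _ _ r' s' hrs', E3, E4,
    Kl_reduce hb''0 hq0 hdq]
  ring
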